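/- Let ε be a completely multiplicative sign function and let m be a positive integer. If diff(m) contains at least two distinct primes, then ∑_{d ∣ m, d > 0} ε(m/d)·log(d) = 0. -/

import Mathlib

/-- `diff(m)`: the set of primes `p` with `ε p = -1` and odd `p`-adic valuation of `m`. -/
def diffSet (ε : ℕ → ℤ) (m : ℕ) : Set ℕ :=
  {p | p.Prime ∧ ε p = -1 ∧ Odd (m.factorization p)}

/-- A sum over the divisors of a product of coprime numbers is a double sum. -/
theorem Nat.Coprime.sum_divisors_mul_eq {M : Type*} [AddCommMonoid M] {a b : ℕ}
    (hab : a.Coprime b) (f : ℕ → M) :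
    ∑ d ∈ (a * b).divisors, f d = ∑ x ∈ a.divisors, ∑ y ∈ b.divisors, f (x * y) := by
  rw [← Finset.sum_product', Nat.divisors_mul, Finset.mul_def,
    Finset.sum_image hab.mul_injOn_divisors]

/-- The sum of `ε` over the divisors of `m` vanishes as soon as `diff(m)` is nonempty. -/
theorem sum_divisors_eq_zero_of_mem_diffSet {ε : ℕ → ℤ} (hε1 : ε 1 = 1)
    (hεmul : ∀ a b : ℕ, 0 < a → 0 < b → ε (a * b) = ε a * ε b)
    {m q : ℕ} (hm : 0 < m) (hq : q ∈ diffSet ε m) :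
    ∑ d ∈ m.divisors, ε d = 0 := by
  obtain ⟨hp, hεq, hodd⟩ := hq
  have hpow (k : ℕ) : ε (q ^ k) = (-1) ^ k := by
    induction k with
    | zero => simpa using hε1
    | succ k ih => rw [pow_succ, hεmul _ _ (pow_pos hp.pos k) hp.pos, ih, hεq, pow_succ]
  have hcop := (Nat.coprime_ordCompl hp hm.ne').pow_left (m.factorization q)
  rw [← Nat.ordProj_mul_ordCompl_eq_self m q, hcop.sum_divisors_mul_eq,
    Nat.sum_divisors_prime_pow hp, Finset.sum_comm]
  refine Finset.sum_eq_zero fun y hy => ?_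
  rw [Finset.sum_congr rfl fun k _ => by
      rw [hεmul _ _ (pow_pos hp.pos k) (Nat.pos_of_mem_divisors hy), hpow],
    ← Finset.sum_mul, neg_one_geom_sum, if_pos hodd.add_one, zero_mul]

/-- Gross–Zagier evaluation (p. 192): if `diff(m)` contains at least two distinct primes,
then `∑_{d ∣ m} ε(m/d) log d = 0`. -/
theorem gz_sum_eq_zero_of_two_mem_diff (ε : ℕ → ℤ)
    (hε1 : ε 1 = 1)
    (hεmul : ∀ a b : ℕ, 0 < a → 0 < b → ε (a * b) = ε a * ε b)
    (hεsign : ∀ p : ℕ, p.Prime → ε p = 1 ∨ ε p = -1)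
    (m : ℕ) (hm : 0 < m) (q₁ q₂ : ℕ) (hq₁ : q₁ ∈ diffSet ε m) (hq₂ : q₂ ∈ diffSet ε m)
    (hne : q₁ ≠ q₂) :
    ∑ d ∈ m.divisors, (ε (m / d) : ℝ) * Real.log d = 0 := by
  obtain ⟨hp₁, hεq₁, hodd₁⟩ := hq₁
  obtain ⟨hp₂, hεq₂, hodd₂⟩ := hq₂
  have hcop := (Nat.coprime_ordCompl hp₁ hm.ne').pow_left (m.factorization q₁)
  have hfac := Nat.ordProj_mul_ordCompl_eq_self m q₁
  have ha : 0 < q₁ ^ m.factorization q₁ := pow_pos hp₁.pos _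
  have hb : 0 < m / q₁ ^ m.factorization q₁ := Nat.ordCompl_pos q₁ hm.ne'
  have hEa : q₁ ∈ diffSet ε (q₁ ^ m.factorization q₁) :=
    ⟨hp₁, hεq₁, by simpa [hp₁.factorization] using hodd₁⟩
  have hEb : q₂ ∈ diffSet ε (m / q₁ ^ m.factorization q₁) :=
    ⟨hp₂, hεq₂, by simpa [Nat.factorization_ordCompl, Finsupp.erase_ne hne.symm] using hodd₂⟩
  generalize q₁ ^ m.factorization q₁ = a at *
  generalize m / a = b at *
  subst hfac
  have hquot {n q : ℕ} (hn : 0 < n) (hq : q ∈ diffSet ε n) :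
      ∑ d ∈ n.divisors, (ε (n / d) : ℝ) = 0 := by
    rw [Nat.sum_div_divisors n fun d => (ε d : ℝ)]
    exact_mod_cast sum_divisors_eq_zero_of_mem_diffSet hε1 hεmul hn hq
  have hsplit : ∀ x ∈ a.divisors, ∀ y ∈ b.divisors,
      (ε (a * b / (x * y)) : ℝ) * Real.log (x * y : ℕ) =
        ε (a / x) * Real.log x * ε (b / y) + ε (a / x) * (ε (b / y) * Real.log y) := by
    intro x hx y hy
    have hxa := Nat.dvd_of_mem_divisors hx
    have hyb := Nat.dvd_of_mem_divisors hy
    have hx0 := Nat.pos_of_mem_divisors hx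
    have hy0 := Nat.pos_of_mem_divisors hy
    rw [Nat.mul_div_mul_comm hxa hyb,
      hεmul _ _ (Nat.div_pos (Nat.le_of_dvd ha hxa) hx0) (Nat.div_pos (Nat.le_of_dvd hb hyb) hy0),
      Nat.cast_mul, Real.log_mul (by positivity) (by positivity)]
    push_cast
    ring
  rw [hcop.sum_divisors_mul_eq, Finset.sum_congr rfl fun x hx => Finset.sum_congr rfl (hsplit x hx)]
  simp only [Finset.sum_add_distrib, ← Finset.mul_sum, ← Finset.sum_mul, hquot ha hEa,
    hquot hb hEb, mul_zero, zero_mul, Finset.sum_const_zero, add_zero]
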